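/- If G and H are premotive games (over posets A and B respectively), then the sum G+H (a game over A×B) is premotive. -/

import Mathlib

/-- Games over a poset `α`: atomic games `[a]` for `a : α`, and composite games
`⟨L|R⟩` given by nonempty families of left and right options. -/
inductive Game (α : Type) : Type 1 where
  | atom : α → Game α
  | comp : (ι κ : Type) → (ι → Game α) → (κ → Game α) → Nonempty ι → Nonempty κ → Game α

namespace Game

variable {α β : Type}

/-- `G'` is a left option of the game. -/
def IsLeftOption (G' : Game α) : Game α → Prop
  | atom _ => False
  | comp _ _ L _ _ _ => ∃ i, L i = G'

/-- `G'` is a right option of the game. -/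
def IsRightOption (G' : Game α) : Game α → Prop
  | atom _ => False
  | comp _ _ _ R _ _ => ∃ k, R k = G'

/-- `G'` is an option of `G`. -/
def IsOption (G' G : Game α) : Prop := IsLeftOption G' G ∨ IsRightOption G' G

/-- A game is composite if it is not atomic. -/
def IsComposite : Game α → Prop
  | atom _ => False
  | comp _ _ _ _ _ _ => True

/-- `G'` is a follower of `G`: `G` itself, an option of `G`, or recursively a follower
of an option of `G`. -/
def IsFollower (G' G : Game α) : Prop := Relation.ReflTransGen IsOption G' G

/-- The dual game: Left and Right switch sides; it is a game over the opposite poset. -/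
def dual : Game α → Game αᵒᵈ
  | atom a => atom (OrderDual.toDual a)
  | comp ι κ L R hι hκ => comp κ ι (fun k => (R k).dual) (fun i => (L i).dual) hκ hι

/-- The image of a game under a (monotone) function applied to atoms. -/
def map (f : α → β) : Game α → Game β
  | atom a => atom (f a)
  | comp ι κ L R hι hκ => comp ι κ (fun i => (L i).map f) (fun k => (R k).map f) hι hκ

/-- The (disjunctive) sum of a game over `α` and a game over `β`, a game over `α × β`. -/
noncomputable def add : Game α → Game β → Game (α × β) := by
  intro G
  induction G with
  | atom g =>
    intro H
    induction H with
    | atom h => exact atom (g, h)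
    | comp ι κ L R hι hκ IHL IHR => exact comp ι κ IHL IHR hι hκ
  | comp ι κ L R hι hκ IHL IHR =>
    intro H
    induction H with
    | atom h => exact comp ι κ (fun i => IHL i (atom h)) (fun k => IHR k (atom h)) hι hκ
    | comp ι' κ' L' R' hι' hκ' IHL' IHR' =>
      exact comp (ι ⊕ ι') (κ ⊕ κ')
        (Sum.elim (fun i => IHL i (comp ι' κ' L' R' hι' hκ')) IHL')
        (Sum.elim (fun k => IHR k (comp ι' κ' L' R' hι' hκ')) IHR')
        (hι.elim fun i => ⟨Sum.inl i⟩) (hκ.elim fun k => ⟨Sum.inl k⟩)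

mutual
/-- Left has a first player winning strategy in a game over the boolean poset:
either the game is the atom `⊤`, or some left option has a second player
winning strategy for Left. -/
inductive LeftWinsFirst : Game Bool → Prop where
  | atom_top : LeftWinsFirst (atom true)
  | move {G G' : Game Bool} : IsLeftOption G' G → LeftWinsSecond G' → LeftWinsFirst G

/-- Left has a second player winning strategy in a game over the boolean poset:
every right option has a first player winning strategy for Left, and if the game
is atomic it is the atom `⊤`. -/
inductive LeftWinsSecond : Game Bool → Prop where
  | mk {G : Game Bool} : (∀ G', IsRightOption G' G → LeftWinsFirst G') →
      (∀ b, G = atom b → b = true) → LeftWinsSecond G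
end

mutual
/-- A game is even if all of its options are odd (atomic games are even). -/
inductive Even {α : Type} : Game α → Prop where
  | mk {G : Game α} : (∀ G', IsOption G' G → Odd G') → Even G

/-- A game is odd if it is composite and all of its options are even. -/
inductive Odd {α : Type} : Game α → Prop where
  | mk {G : Game α} : G.IsComposite → (∀ G', IsOption G' G → Even G') → Odd G
end

/-- A game has parity if it is even or odd. -/
def HasParity (G : Game α) : Prop := Even G ∨ Odd G

/-- `G` and `H` have matching parity (both even or both odd). -/
def MatchingParity (G H : Game α) : Prop := (Even G ∧ Even H) ∨ (Odd G ∧ Odd H)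

/-- `G` and `H` have mismatching parity (one even, the other odd). -/
def MismatchParity (G H : Game α) : Prop := (Even G ∧ Odd H) ∨ (Odd G ∧ Even H)

mutual
/-- The intrinsic order `G ≤ H` on games over a poset: every left option `G^L` of `G`
satisfies `G^L ◁ H`, every right option `H^R` of `H` satisfies `G ◁ H^R`, and if
both games are atoms `[g]`, `[h]` then `g ≤ h`. -/
inductive Le {α : Type} [PartialOrder α] : Game α → Game α → Prop where
  | mk {G H : Game α} :
      (∀ G', IsLeftOption G' G → Tri G' H) →
      (∀ H', IsRightOption H' H → Tri G H') →
      (∀ g h, G = atom g → H = atom h → g ≤ h) →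
      Le G H

/-- The intrinsic relation `G ◁ H` on games over a poset: some right option `G^R` of `G`
satisfies `G^R ≤ H`, or some left option `H^L` of `H` satisfies `G ≤ H^L`. -/
inductive Tri {α : Type} [PartialOrder α] : Game α → Game α → Prop where
  | inr {G H G' : Game α} : IsRightOption G' G → Le G' H → Tri G H
  | inl {G H H' : Game α} : IsLeftOption H' H → Le G H' → Tri G H
end

/-- The comparison game `λ(Gᵒᵖ + H)`, a game over the boolean poset, where
`λ : αᵒᵈ × α → 𝔹` is the monotone map with `λ(xᵒᵖ, y) = ⊤` iff `x ≤ y`. -/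
noncomputable def comparison [PartialOrder α] (G H : Game α) : Game Bool :=
  map (fun p : αᵒᵈ × α => @decide (OrderDual.ofDual p.1 ≤ p.2) (Classical.propDecidable _))
    (G.dual.add H)

/-- A game is locally premotive if Left has a first player winning strategy in
the comparison game `λ(Gᵒᵖ + G)`. -/
def LocallyPremotive [PartialOrder α] (G : Game α) : Prop := LeftWinsFirst (comparison G G)

/-- A game is premotive if it and all of its followers are locally premotive. -/
def Premotive [PartialOrder α] (G : Game α) : Prop :=
  ∀ G', IsFollower G' G → LocallyPremotive G'

/-- The game `* = ⟨0|0⟩` over the one-element poset. -/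
def star : Game Unit := comp Unit Unit (fun _ => atom ()) (fun _ => atom ()) ⟨()⟩ ⟨()⟩

/-- `G + *`, identified with a game over `α` via the isomorphism `α × 1 ≅ α`. -/
noncomputable def addStar (G : Game α) : Game α := map Prod.fst (G.add star)

/-- A game is locally `*`-antimonotone if `G^L + * ≤ G ≤ G^R + *` for all left and
right options `G^L`, `G^R`. -/
def LocallyStarAnti [PartialOrder α] (G : Game α) : Prop :=
  (∀ G', IsLeftOption G' G → Le G'.addStar G) ∧ (∀ G', IsRightOption G' G → Le G G'.addStar)

/-- A game is `*`-antimonotone if it and all of its followers are locally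
`*`-antimonotone. -/
def StarAnti [PartialOrder α] (G : Game α) : Prop :=
  ∀ G', IsFollower G' G → LocallyStarAnti G'

/-- `ε(G + X)`: the game `G` over `α` embedded in a context `X`, a game over the poset
`[α, 𝔹]` of monotone functions `α → 𝔹`, via the application map `ε(a, f) = f a`. -/
noncomputable def ctxSum [PartialOrder α] (G : Game α) (X : Game (α →o Bool)) : Game Bool :=
  map (fun p : α × (α →o Bool) => p.2 p.1) (G.add X)

/-- The outcome `(o_L(G), o_R(G)) ∈ 𝔹 × 𝔹` of a game over the boolean poset:
`o_L(G) = ⊤` iff Left has a first player winning strategy and `o_R(G) = ⊤` iff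
Left has a second player winning strategy. -/
noncomputable def outcome (G : Game Bool) : Bool × Bool :=
  (@decide (LeftWinsFirst G) (Classical.propDecidable _),
   @decide (LeftWinsSecond G) (Classical.propDecidable _))

/-- The contextual order `G ≤_c H`: `o(G+X) ≤ o(H+X)` for every context `X`. -/
def ContextualLe [PartialOrder α] (G H : Game α) : Prop :=
  ∀ X : Game (α →o Bool), outcome (ctxSum G X) ≤ outcome (ctxSum H X)

/-- The contextual relation `G ◁_c H`: `o_R(G+X) ≤ o_L(H+X)` for every context `X`. -/
def ContextualTri [PartialOrder α] (G H : Game α) : Prop :=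
  ∀ X : Game (α →o Bool), (outcome (ctxSum G X)).2 ≤ (outcome (ctxSum H X)).1

/-- Two games are identical when they are equal as set-based games: both are the same
atom, or both are composite with identical sets of left options and identical sets of
right options (recursively). -/
def Identical : Game α → Game α → Prop
  | atom a, atom b => a = b
  | comp _ _ L R _ _, comp _ _ L' R' _ _ =>
      ((∀ i, ∃ i', Identical (L i) (L' i')) ∧ (∀ i', ∃ i, Identical (L i) (L' i'))) ∧
      ((∀ k, ∃ k', Identical (R k) (R' k')) ∧ (∀ k', ∃ k, Identical (R k) (R' k')))
  | _, _ => False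

theorem isLeftOption_add {G : Game α} {H : Game β} {Z : Game (α × β)} :
    IsLeftOption Z (add G H) ↔
      (∃ G', IsLeftOption G' G ∧ Z = add G' H) ∨ (∃ H', IsLeftOption H' H ∧ Z = add G H') := by
  cases G with
  | atom g =>
    cases H with
    | atom h => simp [add, IsLeftOption]
    | comp ι κ L R hι hκ =>
      constructor
      · rintro ⟨i, rfl⟩
        exact Or.inr ⟨_, ⟨i, rfl⟩, rfl⟩
      · rintro (⟨_, h, _⟩ | ⟨_, ⟨i, rfl⟩, rfl⟩)
        · exact h.elim
        · exact ⟨i, rfl⟩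
  | comp ι κ L R hι hκ =>
    cases H with
    | atom h =>
      constructor
      · rintro ⟨i, rfl⟩
        exact Or.inl ⟨_, ⟨i, rfl⟩, rfl⟩
      · rintro (⟨_, ⟨i, rfl⟩, rfl⟩ | ⟨_, h, _⟩)
        · exact ⟨i, rfl⟩
        · exact h.elim
    | comp ι' κ' L' R' hι' hκ' =>
      constructor
      · rintro ⟨i | i, rfl⟩
        · exact Or.inl ⟨_, ⟨i, rfl⟩, rfl⟩
        · exact Or.inr ⟨_, ⟨i, rfl⟩, rfl⟩
      · rintro (⟨_, ⟨i, rfl⟩, rfl⟩ | ⟨_, ⟨i, rfl⟩, rfl⟩)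
        · exact ⟨Sum.inl i, rfl⟩
        · exact ⟨Sum.inr i, rfl⟩

theorem isRightOption_add {G : Game α} {H : Game β} {Z : Game (α × β)} :
    IsRightOption Z (add G H) ↔
      (∃ G', IsRightOption G' G ∧ Z = add G' H) ∨ (∃ H', IsRightOption H' H ∧ Z = add G H') := by
  cases G with
  | atom g =>
    cases H with
    | atom h => simp [add, IsRightOption]
    | comp ι κ L R hι hκ =>
      constructor
      · rintro ⟨i, rfl⟩
        exact Or.inr ⟨_, ⟨i, rfl⟩, rfl⟩
      · rintro (⟨_, h, _⟩ | ⟨_, ⟨i, rfl⟩, rfl⟩)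
        · exact h.elim
        · exact ⟨i, rfl⟩
  | comp ι κ L R hι hκ =>
    cases H with
    | atom h =>
      constructor
      · rintro ⟨i, rfl⟩
        exact Or.inl ⟨_, ⟨i, rfl⟩, rfl⟩
      · rintro (⟨_, ⟨i, rfl⟩, rfl⟩ | ⟨_, h, _⟩)
        · exact ⟨i, rfl⟩
        · exact h.elim
    | comp ι' κ' L' R' hι' hκ' =>
      constructor
      · rintro ⟨i | i, rfl⟩
        · exact Or.inl ⟨_, ⟨i, rfl⟩, rfl⟩
        · exact Or.inr ⟨_, ⟨i, rfl⟩, rfl⟩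
      · rintro (⟨_, ⟨i, rfl⟩, rfl⟩ | ⟨_, ⟨i, rfl⟩, rfl⟩)
        · exact ⟨Sum.inl i, rfl⟩
        · exact ⟨Sum.inr i, rfl⟩

theorem add_eq_atom {G : Game α} {H : Game β} {p : α × β} :
    add G H = atom p ↔ G = atom p.1 ∧ H = atom p.2 := by
  cases G <;> cases H <;> simp [add, Prod.ext_iff]

theorem isLeftOption_dual {G : Game α} {Z : Game αᵒᵈ} :
    IsLeftOption Z G.dual ↔ ∃ G', IsRightOption G' G ∧ Z = G'.dual := by
  cases G <;> simp [dual, IsLeftOption, IsRightOption, eq_comm]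

theorem isRightOption_dual {G : Game α} {Z : Game αᵒᵈ} :
    IsRightOption Z G.dual ↔ ∃ G', IsLeftOption G' G ∧ Z = G'.dual := by
  cases G <;> simp [dual, IsLeftOption, IsRightOption, eq_comm]

theorem dual_eq_atom {G : Game α} {p : αᵒᵈ} :
    G.dual = atom p ↔ G = atom (OrderDual.ofDual p) := by
  cases G
  · simp only [dual, atom.injEq]; exact Iff.rfl
  · simp [dual]

theorem isLeftOption_map {f : α → β} {G : Game α} {Z : Game β} :
    IsLeftOption Z (G.map f) ↔ ∃ G', IsLeftOption G' G ∧ Z = G'.map f := by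
  cases G <;> simp [map, IsLeftOption, eq_comm]

theorem isRightOption_map {f : α → β} {G : Game α} {Z : Game β} :
    IsRightOption Z (G.map f) ↔ ∃ G', IsRightOption G' G ∧ Z = G'.map f := by
  cases G <;> simp [map, IsRightOption, eq_comm]

theorem map_eq_atom {f : α → β} {G : Game α} {b : β} :
    G.map f = atom b ↔ ∃ a, G = atom a ∧ f a = b := by
  cases G <;> simp [map]

/-- Left wins the comparison game moving first. -/
def LF [PartialOrder α] (G H : Game α) : Prop := LeftWinsFirst (comparison G H)
/-- Left wins the comparison game moving second. -/
def LS [PartialOrder α] (G H : Game α) : Prop := LeftWinsSecond (comparison G H)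

theorem isLeftOption_comparison [PartialOrder α] {G H : Game α} {Z : Game Bool} :
    IsLeftOption Z (comparison G H) ↔
      (∃ G', IsRightOption G' G ∧ Z = comparison G' H) ∨
      (∃ H', IsLeftOption H' H ∧ Z = comparison G H') := by
  unfold comparison
  rw [isLeftOption_map]
  constructor
  · rintro ⟨W, hW, rfl⟩
    rcases isLeftOption_add.1 hW with ⟨D, hD, rfl⟩ | ⟨D, hD, rfl⟩
    · obtain ⟨G', h, rfl⟩ := isLeftOption_dual.1 hD
      exact Or.inl ⟨G', h, rfl⟩
    · exact Or.inr ⟨D, hD, rfl⟩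
  · rintro (⟨D, hD, rfl⟩ | ⟨D, hD, rfl⟩)
    · exact ⟨_, isLeftOption_add.2 (Or.inl ⟨_, isLeftOption_dual.2 ⟨D, hD, rfl⟩, rfl⟩), rfl⟩
    · exact ⟨_, isLeftOption_add.2 (Or.inr ⟨D, hD, rfl⟩), rfl⟩

theorem isRightOption_comparison [PartialOrder α] {G H : Game α} {Z : Game Bool} :
    IsRightOption Z (comparison G H) ↔
      (∃ G', IsLeftOption G' G ∧ Z = comparison G' H) ∨
      (∃ H', IsRightOption H' H ∧ Z = comparison G H') := by
  unfold comparison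
  rw [isRightOption_map]
  constructor
  · rintro ⟨W, hW, rfl⟩
    rcases isRightOption_add.1 hW with ⟨D, hD, rfl⟩ | ⟨D, hD, rfl⟩
    · obtain ⟨G', h, rfl⟩ := isRightOption_dual.1 hD
      exact Or.inl ⟨G', h, rfl⟩
    · exact Or.inr ⟨D, hD, rfl⟩
  · rintro (⟨D, hD, rfl⟩ | ⟨D, hD, rfl⟩)
    · exact ⟨_, isRightOption_add.2 (Or.inl ⟨_, isRightOption_dual.2 ⟨D, hD, rfl⟩, rfl⟩), rfl⟩
    · exact ⟨_, isRightOption_add.2 (Or.inr ⟨D, hD, rfl⟩), rfl⟩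

theorem comparison_eq_atom [PartialOrder α] {G H : Game α} {b : Bool} :
    comparison G H = atom b ↔ ∃ g h, G = atom g ∧ H = atom h ∧ (b = true ↔ g ≤ h) := by
  unfold comparison
  rw [map_eq_atom]
  constructor
  · rintro ⟨p, hp, hb⟩
    obtain ⟨h1, h2⟩ := add_eq_atom.1 hp
    refine ⟨_, _, dual_eq_atom.1 h1, h2, ?_⟩
    rw [← hb]; simp
  · rintro ⟨g, h, rfl, rfl, hb⟩
    refine ⟨(OrderDual.toDual g, h), rfl, ?_⟩
    rw [Bool.eq_iff_iff, hb]; exact @decide_eq_true_iff _ (Classical.propDecidable _)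

theorem LF_iff [PartialOrder α] {G H : Game α} :
    LF G H ↔ (∃ g h, G = atom g ∧ H = atom h ∧ g ≤ h) ∨
      (∃ G', IsRightOption G' G ∧ LS G' H) ∨ (∃ H', IsLeftOption H' H ∧ LS G H') := by
  constructor
  · intro h
    unfold LF at h
    generalize hZ : comparison G H = Z at h
    cases h with
    | atom_top =>
      obtain ⟨g, h, h1, h2, h3⟩ := comparison_eq_atom.1 hZ
      exact Or.inl ⟨g, h, h1, h2, h3.1 rfl⟩
    | move ho hs =>
      subst hZ
      rcases isLeftOption_comparison.1 ho with ⟨D, hD, rfl⟩ | ⟨D, hD, rfl⟩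
      · exact Or.inr (Or.inl ⟨D, hD, hs⟩)
      · exact Or.inr (Or.inr ⟨D, hD, hs⟩)
  · rintro (⟨g, h, h1, h2, h3⟩ | ⟨D, hD, hs⟩ | ⟨D, hD, hs⟩)
    · unfold LF
      rw [comparison_eq_atom.2 ⟨g, h, h1, h2, iff_of_true rfl h3⟩]
      exact .atom_top
    · exact .move (isLeftOption_comparison.2 (Or.inl ⟨D, hD, rfl⟩)) hs
    · exact .move (isLeftOption_comparison.2 (Or.inr ⟨D, hD, rfl⟩)) hs

theorem LS_iff [PartialOrder α] {G H : Game α} :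
    LS G H ↔ (∀ G', IsLeftOption G' G → LF G' H) ∧ (∀ H', IsRightOption H' H → LF G H') ∧
      (∀ g h, G = atom g → H = atom h → g ≤ h) := by
  constructor
  · intro h
    unfold LS at h
    cases h with
    | mk h1 h2 =>
      refine ⟨fun D hD => h1 _ (isRightOption_comparison.2 (Or.inl ⟨D, hD, rfl⟩)),
        fun D hD => h1 _ (isRightOption_comparison.2 (Or.inr ⟨D, hD, rfl⟩)), ?_⟩
      intro g h hg hh
      classical
      have := h2 (decide (g ≤ h)) (comparison_eq_atom.2 ⟨g, h, hg, hh, by simp⟩)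
      simpa using this
  · rintro ⟨h1, h2, h3⟩
    refine .mk ?_ ?_
    · intro Z hZ
      rcases isRightOption_comparison.1 hZ with ⟨D, hD, rfl⟩ | ⟨D, hD, rfl⟩
      · exact h1 D hD
      · exact h2 D hD
    · intro b hb
      obtain ⟨g, h, hg, hh, hb⟩ := comparison_eq_atom.1 hb
      exact hb.2 (h3 g h hg hh)

theorem wf_isOption : WellFounded (IsOption : Game α → Game α → Prop) := by
  constructor
  intro G
  induction G with
  | atom a => exact ⟨_, fun y h => by rcases h with h | h <;> exact h.elim⟩
  | comp ι κ L R hι hκ ihL ihR =>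
    refine ⟨_, fun y h => ?_⟩
    rcases h with ⟨i, rfl⟩ | ⟨k, rfl⟩
    · exact ihL i
    · exact ihR k

theorem atom_add_cmp [PartialOrder α] [PartialOrder β] {x y : α} (hxy : x ≤ y)
    (H K : Game β) :
    (LS H K → LS (add (atom x) H) (add (atom y) K)) ∧
    (LF H K → LF (add (atom x) H) (add (atom y) K)) := by
  induction H using wf_isOption.induction generalizing K with
  | _ H ihH =>
  induction K using wf_isOption.induction with
  | _ K ihK =>
  constructor
  · intro h
    obtain ⟨h1, h2, h3⟩ := LS_iff.1 h
    refine LS_iff.2 ⟨?_, ?_, ?_⟩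
    · intro Z hZ
      rcases isLeftOption_add.1 hZ with ⟨D, hD, rfl⟩ | ⟨D, hD, rfl⟩
      · exact hD.elim
      · exact (ihH D (Or.inl hD) K).2 (h1 D hD)
    · intro Z hZ
      rcases isRightOption_add.1 hZ with ⟨D, hD, rfl⟩ | ⟨D, hD, rfl⟩
      · exact hD.elim
      · exact (ihK D (Or.inr hD)).2 (h2 D hD)
    · intro p q hp hq
      obtain ⟨hp1, hp2⟩ := add_eq_atom.1 hp
      obtain ⟨hq1, hq2⟩ := add_eq_atom.1 hq
      injection hp1 with hp1
      injection hq1 with hq1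
      exact ⟨by rw [← hp1, ← hq1]; exact hxy, h3 _ _ hp2 hq2⟩
  · intro h
    rcases LF_iff.1 h with ⟨g, k, rfl, rfl, h3⟩ | ⟨D, hD, hs⟩ | ⟨D, hD, hs⟩
    · exact LF_iff.2 (Or.inl ⟨(x, g), (y, k), rfl, rfl, ⟨hxy, h3⟩⟩)
    · exact LF_iff.2 (Or.inr (Or.inl ⟨_, isRightOption_add.2 (Or.inr ⟨D, hD, rfl⟩),
        (ihH D (Or.inr hD) K).1 hs⟩))
    · exact LF_iff.2 (Or.inr (Or.inr ⟨_, isLeftOption_add.2 (Or.inr ⟨D, hD, rfl⟩),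
        (ihK D (Or.inl hD)).1 hs⟩))

theorem Premotive.option [PartialOrder α] {G G' : Game α} (h : Premotive G)
    (ho : IsOption G' G) : Premotive G' :=
  fun _ hZ => h _ (Relation.ReflTransGen.tail hZ ho)

theorem add_cmp_same [PartialOrder α] [PartialOrder β] (H : Game β) (hH : Premotive H)
    (X Y : Game α) :
    (LS X Y → LS (add X H) (add Y H)) ∧ (LF X Y → LF (add X H) (add Y H)) := by
  induction H using wf_isOption.induction generalizing X Y with
  | _ H ihH =>
  induction X using wf_isOption.induction generalizing Y with
  | _ X ihX =>
  induction Y using wf_isOption.induction with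
  | _ Y ihY =>
  constructor
  · intro h
    obtain ⟨h1, h2, h3⟩ := LS_iff.1 h
    refine LS_iff.2 ⟨?_, ?_, ?_⟩
    · intro Z hZ
      rcases isLeftOption_add.1 hZ with ⟨D, hD, rfl⟩ | ⟨D, hD, rfl⟩
      · exact (ihX D (Or.inl hD) Y).2 (h1 D hD)
      · exact LF_iff.2 (Or.inr (Or.inr ⟨_, isLeftOption_add.2 (Or.inr ⟨D, hD, rfl⟩),
          (ihH D (Or.inl hD) (hH.option (Or.inl hD)) X Y).1 h⟩))
    · intro Z hZ
      rcases isRightOption_add.1 hZ with ⟨D, hD, rfl⟩ | ⟨D, hD, rfl⟩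
      · exact (ihY D (Or.inr hD)).2 (h2 D hD)
      · exact LF_iff.2 (Or.inr (Or.inl ⟨_, isRightOption_add.2 (Or.inr ⟨D, hD, rfl⟩),
          (ihH D (Or.inr hD) (hH.option (Or.inr hD)) X Y).1 h⟩))
    · intro p q hp hq
      obtain ⟨hp1, hp2⟩ := add_eq_atom.1 hp
      obtain ⟨hq1, hq2⟩ := add_eq_atom.1 hq
      rw [hp2] at hq2
      injection hq2 with hq2
      exact ⟨h3 _ _ hp1 hq1, hq2.le⟩
  · intro h
    rcases LF_iff.1 h with ⟨g, k, rfl, rfl, h3⟩ | ⟨D, hD, hs⟩ | ⟨D, hD, hs⟩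
    · exact (atom_add_cmp h3 H H).2 (hH H .refl)
    · exact LF_iff.2 (Or.inr (Or.inl ⟨_, isRightOption_add.2 (Or.inl ⟨D, hD, rfl⟩),
        (ihX D (Or.inr hD) Y).1 hs⟩))
    · exact LF_iff.2 (Or.inr (Or.inr ⟨_, isLeftOption_add.2 (Or.inl ⟨D, hD, rfl⟩),
        (ihY D (Or.inl hD)).1 hs⟩))

theorem isOption_add {G : Game α} {H : Game β} {Z : Game (α × β)} (h : IsOption Z (add G H)) :
    (∃ G', IsOption G' G ∧ Z = add G' H) ∨ (∃ H', IsOption H' H ∧ Z = add G H') := by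
  rcases h with h | h
  · rcases isLeftOption_add.1 h with ⟨D, hD, rfl⟩ | ⟨D, hD, rfl⟩
    · exact Or.inl ⟨D, Or.inl hD, rfl⟩
    · exact Or.inr ⟨D, Or.inl hD, rfl⟩
  · rcases isRightOption_add.1 h with ⟨D, hD, rfl⟩ | ⟨D, hD, rfl⟩
    · exact Or.inl ⟨D, Or.inr hD, rfl⟩
    · exact Or.inr ⟨D, Or.inr hD, rfl⟩

/-- The sum of premotive games is premotive. -/
theorem add_premotive {α β : Type} [PartialOrder α] [PartialOrder β]
    (G : Game α) (H : Game β) (hG : Premotive G) (hH : Premotive H) :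
    Premotive (add G H) := by
  intro Z hZ
  have key : ∃ G' H', Premotive G' ∧ Premotive H' ∧ Z = add G' H' := by
    induction hZ using Relation.ReflTransGen.head_induction_on with
    | refl => exact ⟨G, H, hG, hH, rfl⟩
    | head ho _ ih =>
      obtain ⟨G', H', h1, h2, rfl⟩ := ih
      rcases isOption_add ho with ⟨D, hD, rfl⟩ | ⟨D, hD, rfl⟩
      · exact ⟨D, H', h1.option hD, h2, rfl⟩
      · exact ⟨G', D, h1, h2.option hD, rfl⟩
  obtain ⟨G', H', h1, h2, rfl⟩ := key
  exact (add_cmp_same H' h2 G' G').2 (h1 G' .refl)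

end Game
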